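/- Let n ≥ 2, let A be a unital associative algebra over a commutative unital ring R that is 2-torsion free and (n−1)-torsion free, and let s ≥ 3. Then every Lie n-derivation on the full matrix algebra M_s(A) of s×s matrices over A is standard. -/

import Mathlib

open Finset

/-- Iterated commutator: `pCom x k = p_{k+1}(x 0, ..., x k)`, i.e.
`pCom x 0 = x 0` and `pCom x (k+1) = [pCom x k, x (k+1)]`. -/
def pCom {A : Type*} [Ring A] (x : ℕ → A) : ℕ → A
  | 0 => x 0
  | k + 1 => pCom x k * x (k + 1) - x (k + 1) * pCom x k

/-- `φ` is a Lie `n`-derivation. -/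
def IsLieNDeriv {R : Type*} {A : Type*} [CommRing R] [Ring A] [Algebra R A]
    (n : ℕ) (φ : A →ₗ[R] A) : Prop :=
  ∀ x : ℕ → A,
    φ (pCom x (n - 1)) =
      ∑ i ∈ Finset.range n, pCom (Function.update x i (φ (x i))) (n - 1)

/-- `d` is a derivation. -/
def IsDeriv {R : Type*} {A : Type*} [CommRing R] [Ring A] [Algebra R A]
    (d : A →ₗ[R] A) : Prop :=
  ∀ x y : A, d (x * y) = d x * y + x * d y

/-- `δ` is a Jordan derivation. -/
def IsJordanDeriv {R : Type*} {A : Type*} [CommRing R] [Ring A] [Algebra R A]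
    (δ : A →ₗ[R] A) : Prop :=
  ∀ x y : A, δ (x * y + y * x) = δ x * y + y * δ x + x * δ y + δ y * x

/-- `δ` is an antiderivation. -/
def IsAntiDeriv {R : Type*} {A : Type*} [CommRing R] [Ring A] [Algebra R A]
    (δ : A →ₗ[R] A) : Prop :=
  ∀ x y : A, δ (x * y) = δ y * x + y * δ x

/-- `δ` is a singular Jordan derivation relative to the idempotent `e`
(with `f = 1 - e`): it is a Jordan derivation killing `eAe` and `fAf`,
mapping `eAf` into `fAe` and `fAe` into `eAf`. -/
def IsSingularJordanDeriv {R : Type*} {A : Type*} [CommRing R] [Ring A] [Algebra R A]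
    (e : A) (δ : A →ₗ[R] A) : Prop :=
  IsJordanDeriv δ ∧
  (∀ a : A, δ (e * a * e) = 0) ∧
  (∀ b : A, δ ((1 - e) * b * (1 - e)) = 0) ∧
  (∀ m : A, δ (e * m * (1 - e)) = (1 - e) * δ (e * m * (1 - e)) * e) ∧
  (∀ t : A, δ ((1 - e) * t * e) = e * δ ((1 - e) * t * e) * (1 - e))

/-- `z` is a central element. -/
def IsCent {A : Type*} [Ring A] (z : A) : Prop := ∀ y : A, z * y = y * z

/-- The centre of `A` as a set. -/
def centerSet (A : Type*) [Ring A] : Set A := {z : A | ∀ y : A, z * y = y * z}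

/-- `γ` vanishes on all `(n-1)`-th commutators. -/
def VanishesOnNCommutators {R : Type*} {A : Type*} [CommRing R] [Ring A] [Algebra R A]
    (n : ℕ) (γ : A →ₗ[R] A) : Prop :=
  ∀ x : ℕ → A, γ (pCom x (n - 1)) = 0

/-- A Lie `n`-derivation is standard if it is the sum of a derivation and a
central-valued map vanishing on all `(n-1)`-th commutators. -/
def IsStandardLieNDeriv {R : Type*} {A : Type*} [CommRing R] [Ring A] [Algebra R A]
    (n : ℕ) (φ : A →ₗ[R] A) : Prop :=
  ∃ d γ : A →ₗ[R] A,
    IsDeriv d ∧ (∀ x : A, IsCent (γ x)) ∧ VanishesOnNCommutators n γ ∧ φ = d + γ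

/-- Property (Q) for the idempotent `e` (with `f = 1 - e`):
`exe·eAf = 0 = fAe·exe` implies `exe = 0`, and
`eAf·fxf = 0 = fxf·fAe` implies `fxf = 0`. -/
def PropQ {A : Type*} [Ring A] (e : A) : Prop :=
  (∀ x : A,
    ((∀ y : A, (e * x * e) * (e * y * (1 - e)) = 0) ∧
     (∀ y : A, ((1 - e) * y * e) * (e * x * e) = 0)) → e * x * e = 0) ∧
  (∀ x : A,
    ((∀ y : A, (e * y * (1 - e)) * ((1 - e) * x * (1 - e)) = 0) ∧
     (∀ y : A, ((1 - e) * x * (1 - e)) * ((1 - e) * y * e) = 0)) →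
        (1 - e) * x * (1 - e) = 0)

/-- `A` is `k`-torsion free. -/
def TorsionFreeAt (A : Type*) [Ring A] (k : ℕ) : Prop :=
  ∀ x : A, k • x = 0 → x = 0

/-- The centre of the corner algebra `gAg` (for an idempotent `g`). -/
def cornerCenter {A : Type*} [Ring A] (g : A) : Set A :=
  {z : A | z = g * z * g ∧ ∀ a : A, z * (g * a * g) = (g * a * g) * z}

/-- The corner algebra `gAg` has no nonzero central ideal: every
ideal of `gAg` consisting of elements central in `gAg` is zero. -/
def NoNonzeroCentralIdeal (R : Type*) [CommRing R] (A : Type*) [Ring A] [Algebra R A]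
    (g : A) : Prop :=
  ∀ I : Set A, (0 : A) ∈ I →
    (∀ x ∈ I, x = g * x * g) →
    (∀ x ∈ I, ∀ y ∈ I, x + y ∈ I) →
    (∀ r : R, ∀ x ∈ I, r • x ∈ I) →
    (∀ x ∈ I, ∀ a : A, (g * a * g) * x ∈ I) →
    (∀ x ∈ I, ∀ a : A, x * (g * a * g) ∈ I) →
    (∀ x ∈ I, ∀ a : A, x * (g * a * g) = (g * a * g) * x) →
    ∀ x ∈ I, x = 0

/-- The generating set of `S(gAg)`: all idempotents of `gAg` together with all
commutators of elements of `gAg`. -/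
def cornerGenSet {A : Type*} [Ring A] (g : A) : Set A :=
  {x : A | x = g * x * g ∧ x * x = x} ∪
  {x : A | ∃ a b : A, x = (g * a * g) * (g * b * g) - (g * b * g) * (g * a * g)}

/-- `gAg = S(gAg)`: the corner algebra is generated (as an algebra) by its
idempotents and commutators. -/
def CornerGenerated (R : Type*) [CommRing R] {A : Type*} [Ring A] [Algebra R A]
    (g : A) : Prop :=
  ∀ x : A, g * x * g ∈ NonUnitalAlgebra.adjoin R (cornerGenSet g)

/-- Condition (*) for the corner algebra `gAg`: if `[x, gAg] ⊆ Z(gAg)` then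
`x ∈ Z(gAg)`. -/
def CornerCondStar {A : Type*} [Ring A] (g : A) : Prop :=
  ∀ x : A, x = g * x * g →
    (∀ a : A, x * (g * a * g) - (g * a * g) * x ∈ cornerCenter g) →
    x ∈ cornerCenter g

/-- The commutator `[y, e]`, as a function of `y`. -/
def commRight {M : Type*} [Ring M] (e y : M) : M := y * e - e * y

/-- The sequence `a, b, e, e, e, …`. -/
def pairThen {M : Type*} (a b e : M) : ℕ → M
  | 0 => a
  | 1 => b
  | _ + 2 => e

theorem update_pairThen_zero {M : Type*} (a b e c : M) :
    Function.update (pairThen a b e) 0 c = pairThen c b e := by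
  funext i
  rcases i with _ | _ | i <;> simp [Function.update, pairThen]

theorem update_pairThen_one {M : Type*} (a b e c : M) :
    Function.update (pairThen a b e) 1 c = pairThen a c e := by
  funext i
  rcases i with _ | _ | i <;> simp [Function.update, pairThen]

section Ring

variable {M : Type*} [Ring M]

theorem commRight_iterate_zero (e : M) (k : ℕ) : (commRight e)^[k] 0 = 0 :=
  Function.iterate_fixed (by simp [commRight]) k

theorem pCom_pairThen (a b e : M) (k : ℕ) :
    pCom (pairThen a b e) (k + 1) = (commRight e)^[k] (a * b - b * a) := by
  induction k with
  | zero => rfl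
  | succ k ih =>
    rw [Function.iterate_succ_apply', ← ih]
    rfl

theorem pCom_update_of_lt (x : ℕ → M) (c : M) {i k : ℕ} (h : k < i) :
    pCom (Function.update x i c) k = pCom x k := by
  induction k with
  | zero => simp [pCom, Function.update, h.ne]
  | succ k ih => simp [pCom, ih (by omega), Function.update, h.ne]

theorem pCom_update_self (x : ℕ → M) (c : M) (k : ℕ) :
    pCom (Function.update x (k + 1) c) (k + 1) = pCom x k * c - c * pCom x k := by
  simp [pCom, pCom_update_of_lt x c (Nat.lt_succ_self k)]

theorem pCom_update_succ (x : ℕ → M) (c : M) {i k : ℕ} (h : i ≤ k) :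
    pCom (Function.update x i c) (k + 1) =
      pCom (Function.update x i c) k * x (k + 1) - x (k + 1) * pCom (Function.update x i c) k := by
  have : k + 1 ≠ i := by omega
  simp [pCom, Function.update, this]

theorem pCom_update_sub (x : ℕ → M) (b c : M) {i k : ℕ} (h : i ≤ k) :
    pCom (Function.update x i (b - c)) k =
      pCom (Function.update x i b) k - pCom (Function.update x i c) k := by
  induction k with
  | zero =>
    obtain rfl : i = 0 := by omega
    simp [pCom]
  | succ k ih =>
    rcases Nat.lt_or_ge k i with hi | hi
    · obtain rfl : i = k + 1 := by omega
      simp only [pCom_update_self]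
      noncomm_ring
    · simp only [pCom_update_succ x _ hi, ih hi]
      noncomm_ring

theorem pCom_update_of_isCent (x : ℕ → M) {c : M} (hc : IsCent c) {i k : ℕ} (h : i ≤ k + 1) :
    pCom (Function.update x i c) (k + 1) = 0 := by
  induction k with
  | zero =>
    obtain rfl | rfl : i = 0 ∨ i = 1 := by omega
    · simp [pCom, hc (x 1)]
    · simp [pCom, hc (x 0)]
  | succ k ih =>
    rcases Nat.lt_or_ge (k + 1) i with hi | hi
    · obtain rfl : i = k + 2 := by omega
      rw [pCom_update_self, hc, sub_self]
    · rw [pCom_update_succ x _ hi, ih hi]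
      simp

theorem pCom_update_pairThen_of_commute {a b : M} (hab : a * b = b * a) (e c : M) (i k : ℕ) :
    pCom (Function.update (pairThen a b e) (i + 2) c) (k + 1) = 0 := by
  induction k with
  | zero => simp [pCom, Function.update, pairThen, hab]
  | succ k ih => rw [pCom, ih]; simp

theorem pCom_update_pairThen_of_fixed {a e u : M} (ha : commRight e a = a)
    (hv : commRight e (commRight u a) = commRight u a) {i k : ℕ} (h : i < k) :
    pCom (Function.update (pairThen a e e) (i + 2) u) (k + 1) = commRight u a := by
  have hfix (l : ℕ) : pCom (pairThen a e e) (l + 1) = a := by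
    rw [pCom_pairThen]
    change (commRight e)^[l] (commRight e a) = a
    rw [ha, Function.iterate_fixed ha]
  induction k with
  | zero => omega
  | succ k ih =>
    rcases Nat.lt_or_ge i k with hi | hi
    · rw [pCom_update_succ _ _ (by omega), ih hi]
      exact hv
    · obtain rfl : i = k := by omega
      rw [pCom_update_self, hfix]
      rfl

end Ring

section Algebra

variable {R M : Type*} [CommRing R] [Ring M] [Algebra R M]

theorem IsDeriv.map_pCom {d : M →ₗ[R] M} (hd : IsDeriv d) (x : ℕ → M) (k : ℕ) :
    d (pCom x k) = ∑ i ∈ range (k + 1), pCom (Function.update x i (d (x i))) k := by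
  induction k with
  | zero => simp [pCom]
  | succ k ih =>
    rw [sum_range_succ, pCom_update_self, sum_congr rfl fun i hi =>
      pCom_update_succ x _ (Nat.lt_succ_iff.1 (mem_range.1 hi)), sum_sub_distrib, ← sum_mul,
      ← mul_sum, ← ih]
    simp only [pCom, map_sub, hd _ _]
    abel

theorem IsLieNDeriv.sub_isDeriv {m : ℕ} {φ d : M →ₗ[R] M} (hφ : IsLieNDeriv (m + 2) φ)
    (hd : IsDeriv d) : IsLieNDeriv (m + 2) (φ - d) := by
  intro x
  have h := hd.map_pCom x (m + 1)
  have h' := hφ x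
  simp only [Nat.add_succ_sub_one] at h' ⊢
  rw [LinearMap.sub_apply, h, h', ← sum_sub_distrib]
  refine sum_congr rfl fun i hi => ?_
  rw [LinearMap.sub_apply, pCom_update_sub x _ _ (Nat.lt_succ_iff.1 (mem_range.1 hi))]

theorem IsLieNDeriv.vanishesOnNCommutators {m : ℕ} {φ : M →ₗ[R] M}
    (hφ : IsLieNDeriv (m + 2) φ) (hc : ∀ x, IsCent (φ x)) :
    VanishesOnNCommutators (m + 2) φ := by
  intro x
  rw [hφ x]
  exact sum_eq_zero fun i hi =>
    pCom_update_of_isCent x (hc _) (Nat.lt_succ_iff.1 (mem_range.1 hi))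

theorem IsLieNDeriv.map_commRight_iterate {m : ℕ} {φ : M →ₗ[R] M}
    (hφ : IsLieNDeriv (m + 2) φ) (a b e : M) :
    φ ((commRight e)^[m] (a * b - b * a)) =
      (∑ i ∈ range m, pCom (Function.update (pairThen a b e) (i + 2) (φ e)) (m + 1)) +
        (commRight e)^[m] (a * φ b - φ b * a) + (commRight e)^[m] (φ a * b - b * φ a) := by
  have h := hφ (pairThen a b e)
  simp only [Nat.add_succ_sub_one] at h
  rw [sum_range_succ', sum_range_succ', pCom_pairThen] at h
  simpa only [pairThen, zero_add, update_pairThen_zero, update_pairThen_one, pCom_pairThen] using h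

theorem IsLieNDeriv.map_commRight_iterate_of_isCent {m : ℕ} {φ : M →ₗ[R] M}
    (hφ : IsLieNDeriv (m + 2) φ) {e : M} (he : IsCent (φ e)) (a b : M) :
    φ ((commRight e)^[m] (a * b - b * a)) =
      (commRight e)^[m] (a * φ b - φ b * a) + (commRight e)^[m] (φ a * b - b * φ a) := by
  rw [hφ.map_commRight_iterate, sum_eq_zero, zero_add]
  intro i hi
  have := mem_range.1 hi
  exact pCom_update_of_isCent _ he (by omega)

theorem IsLieNDeriv.map_commRight_iterate_succ {m : ℕ} {φ : M →ₗ[R] M}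
    (hφ : IsLieNDeriv (m + 2) φ) {e : M} (he : IsCent (φ e)) (a : M) :
    φ ((commRight e)^[m + 1] a) = (commRight e)^[m + 1] (φ a) := by
  have h := hφ.map_commRight_iterate_of_isCent he a e
  rwa [← he a, sub_self, commRight_iterate_zero, zero_add] at h

/-- The inner derivation `x ↦ w * x - x * w`. -/
def innerDeriv (R : Type*) {M : Type*} [CommRing R] [Ring M] [Algebra R M] (w : M) : M →ₗ[R] M :=
  LinearMap.mulLeft R w - LinearMap.mulRight R w

theorem innerDeriv_apply (w x : M) : innerDeriv R w x = w * x - x * w := rfl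

theorem isDeriv_innerDeriv (w : M) : IsDeriv (innerDeriv R w) := by
  intro x y
  simp only [innerDeriv_apply]
  noncomm_ring

theorem IsDeriv.add {d d' : M →ₗ[R] M} (hd : IsDeriv d) (hd' : IsDeriv d') :
    IsDeriv (d + d') := by
  intro x y
  simp only [LinearMap.add_apply, hd x y, hd' x y]
  noncomm_ring

end Algebra

section Matrix

open Matrix

variable {ι A : Type*} [Fintype ι] [DecidableEq ι] [Ring A]

theorem mul_single_apply (z : Matrix ι ι A) (i j p q : ι) (a : A) :
    (z * single i j a) p q = if j = q then z p i * a else 0 := by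
  split_ifs with h
  · subst h; simp
  · simp [Ne.symm h]

theorem single_mul_apply (z : Matrix ι ι A) (i j p q : ι) (a : A) :
    (single i j a * z) p q = if i = p then a * z j q else 0 := by
  split_ifs with h
  · subst h; simp
  · simp [Ne.symm h]

theorem commRight_single_apply (k p q : ι) (z : Matrix ι ι A) :
    commRight (single k k 1) z p q = (if k = q then z p q else 0) - if k = p then z p q else 0 := by
  rw [commRight, Matrix.sub_apply, mul_single_apply, single_mul_apply]
  congr 1 <;> split_ifs with h <;> simp [h]

theorem commRight_iterate_apply_right {p q : ι} (h : p ≠ q) (k : ℕ) (z : Matrix ι ι A) :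
    (commRight (single q q 1))^[k] z p q = z p q := by
  induction k with
  | zero => rfl
  | succ k ih => simp [Function.iterate_succ_apply', commRight_single_apply, ih, h.symm]

theorem commRight_iterate_apply_left {p q : ι} (h : p ≠ q) (k : ℕ) (z : Matrix ι ι A) :
    (commRight (single p p 1))^[k] z p q = (-1) ^ k * z p q := by
  induction k with
  | zero => simp
  | succ k ih => simp [Function.iterate_succ_apply', commRight_single_apply, ih, h, pow_succ]

theorem commRight_single_single {i j : ι} (h : i ≠ j) (a : A) :
    commRight (single j j 1) (single i j a) = single i j a := by
  simp [commRight, h.symm]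

theorem commRight_single_of_ne {i j k : ι} (hi : k ≠ i) (hj : k ≠ j) (a : A) :
    commRight (single k k 1) (single i j a) = 0 := by
  simp [commRight, hi, hj.symm]

theorem isCent_of_diagonal {z : Matrix ι ι A} (hz : ∀ p q, p ≠ q → z p q = 0) {o o' : ι}
    (ho : o' ≠ o) (h : ∀ i, i ≠ o → ∀ a, z i i * a = a * z o o) : IsCent z := by
  have hd (i : ι) : z i i = z o o := by
    by_cases hi : i = o
    · rw [hi]
    · simpa using h i hi 1
  have hzd : z = diagonal fun _ => z o o := by
    ext p q
    by_cases hpq : p = q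
    · subst hpq; simp [hd]
    · simp [hpq, hz]
  intro y
  rw [hzd]
  ext p q
  rw [diagonal_mul, mul_diagonal, ← h o' ho, hd o']

variable {R : Type*} [CommRing R] [Algebra R A]

theorem innerDeriv_diagonal_single_one (c : ι → A) (i j : ι) :
    innerDeriv R (diagonal c) (single i j 1) = single i j (c i - c j) := by
  ext p q
  rw [innerDeriv_apply, Matrix.sub_apply, diagonal_mul, mul_diagonal]
  by_cases h : i = p ∧ j = q
  · obtain ⟨rfl, rfl⟩ := h
    simp
  · simp [single_apply_of_ne _ _ _ _ _ h]

theorem isDeriv_mapMatrix {f : A →ₗ[R] A} (hf : IsDeriv f) :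
    IsDeriv (f.mapMatrix : Matrix ι ι A →ₗ[R] Matrix ι ι A) := by
  intro x y
  ext p q
  simp only [LinearMap.mapMatrix_apply, map_apply, Matrix.mul_apply, Matrix.add_apply, map_sum, hf _ _,
    sum_add_distrib]

namespace IsLieNDeriv

variable {m : ℕ} {φ : Matrix ι ι A →ₗ[R] Matrix ι ι A}

theorem map_single_symm (hφ : IsLieNDeriv (m + 2) φ) (i j : ι) :
    φ (single i i 1) * single j j 1 - single j j 1 * φ (single i i 1) =
      φ (single j j 1) * single i i 1 - single i i 1 * φ (single j j 1) := by
  have hc : (single i i 1 * single j j 1 : Matrix ι ι A) = single j j 1 * single i i 1 := by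
    by_cases h : i = j
    · rw [h]
    · simp [h, Ne.symm h]
  ext p q
  by_cases hpq : p = q
  · subst hpq
    simp only [Matrix.sub_apply, mul_single_apply, single_mul_apply]
    split_ifs <;> simp_all
  · have h := hφ.map_commRight_iterate (single i i 1) (single j j 1) (single q q 1)
    rw [sum_eq_zero fun k _ => pCom_update_pairThen_of_commute hc _ _ k m, hc, sub_self,
      commRight_iterate_zero, map_zero, zero_add] at h
    have h' := congrFun (congrFun h p) q
    rw [Matrix.add_apply, commRight_iterate_apply_right hpq, commRight_iterate_apply_right hpq] at h'
    simp only [Matrix.sub_apply, Matrix.zero_apply] at h' ⊢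
    rw [← sub_eq_zero, h']
    abel

theorem isCent_map_single_of_diagonal (hφ : IsLieNDeriv (m + 2) φ)
    (htf : TorsionFreeAt A (m + 1)) {i j : ι} (hij : i ≠ j)
    (hdiag : ∀ p q, p ≠ q → φ (single j j 1) p q = 0) : IsCent (φ (single j j 1)) := by
  refine isCent_of_diagonal hdiag hij fun k hk a => ?_
  set u := φ (single j j 1) with hu
  have hv : commRight u (single k j a) = single k j (a * u j j - u k k * a) := by
    ext p q
    rw [commRight, Matrix.sub_apply, single_mul_apply, mul_single_apply]
    by_cases hp : k = p <;> by_cases hq : j = q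
    · subst hp hq; simp
    · simp [hp, hq, hdiag]
    · simp [hp, hq, hdiag p k (Ne.symm hp)]
    · simp [hp, hq]
  have ha := commRight_single_single hk a
  have hvv : commRight (single j j 1) (commRight u (single k j a)) = commRight u (single k j a) := by
    rw [hv, commRight_single_single hk]
  have h := hφ.map_commRight_iterate (single k j a) (single j j 1) (single j j 1)
  rw [sum_congr rfl fun i hi => pCom_update_pairThen_of_fixed ha hvv (mem_range.1 hi)] at h
  change φ ((commRight _)^[m] (commRight _ _)) =
    _ + (commRight _)^[m] (commRight u _) + (commRight _)^[m] (commRight _ _) at h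
  rw [ha, Function.iterate_fixed ha, Function.iterate_fixed hvv, ← Function.iterate_succ_apply]
    at h
  have h' := congrFun (congrFun h k) j
  rw [Matrix.add_apply, commRight_iterate_apply_right hk, right_eq_add, hv, sum_const, card_range,
    ← succ_nsmul] at h'
  have h0 := htf (a * u j j - u k k * a) (by simpa using h')
  exact (sub_eq_zero.1 h0).symm

theorem exists_isDeriv_isCent (hφ : IsLieNDeriv (m + 2) φ) (htf : TorsionFreeAt A (m + 1))
    (hι : ∀ i : ι, ∃ j, j ≠ i) :
    ∃ d : Matrix ι ι A →ₗ[R] Matrix ι ι A, IsDeriv d ∧ ∀ i, IsCent ((φ - d) (single i i 1)) := by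
  let w : Matrix ι ι A := of fun i j => - φ (single i i 1) i j
  refine ⟨innerDeriv R w, isDeriv_innerDeriv w, fun i => ?_⟩
  obtain ⟨j, hj⟩ := hι i
  refine (hφ.sub_isDeriv (isDeriv_innerDeriv w)).isCent_map_single_of_diagonal htf hj
    fun p q hpq => ?_
  rw [LinearMap.sub_apply, innerDeriv_apply, Matrix.sub_apply, Matrix.sub_apply, mul_single_apply,
    single_mul_apply]
  by_cases hq : i = q
  · subst hq
    have h := congrFun (congrFun (hφ.map_single_symm p i) p) i
    simp only [Matrix.sub_apply, mul_single_apply, single_mul_apply] at h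
    simp [hpq, hpq.symm] at h
    simp [hpq.symm, w, h]
  · have h := congrFun (congrFun (hφ.map_single_symm i q) p) q
    simp only [Matrix.sub_apply, mul_single_apply, single_mul_apply] at h
    by_cases hp : i = p
    · subst hp
      simp [hq, w]
    · simpa [hq, hp, hpq, hpq.symm] using h

theorem map_single_of_ne (hφ : IsLieNDeriv (m + 2) φ) (hc : ∀ i, IsCent (φ (single i i 1)))
    (hι : ∀ i j : ι, ∃ k, k ≠ i ∧ k ≠ j) {i j : ι} (hij : i ≠ j) (a : A) :
    φ (single i j a) = single i j (φ (single i j a) i j) := by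
  obtain ⟨k, hki, hkj⟩ := hι i j
  ext p q
  by_cases hpq : p = q
  · subst hpq
    have h := hφ.map_commRight_iterate_succ (hc j) (single i j a)
    rw [Function.iterate_fixed (commRight_single_single hij a)] at h
    rw [h, Function.iterate_succ_apply', commRight_single_apply, sub_self, single_apply_of_ne]
    rintro ⟨rfl, rfl⟩
    exact hij rfl
  have hvanish {l : ι} (hi : l ≠ i) (hj : l ≠ j) :
      (commRight (single l l 1))^[m + 1] (φ (single i j a)) = 0 := by
    rw [← hφ.map_commRight_iterate_succ (hc l), Function.iterate_succ_apply,
      commRight_single_of_ne hi hj, commRight_iterate_zero, map_zero]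
  have hright (hi : q ≠ i) (hj : q ≠ j) : φ (single i j a) p q = 0 := by
    rw [← commRight_iterate_apply_right hpq (m + 1) (φ (single i j a)), hvanish hi hj, Matrix.zero_apply]
  have hleft (hi : p ≠ i) (hj : p ≠ j) : φ (single i j a) p q = 0 := by
    have h := commRight_iterate_apply_left hpq (m + 1) (φ (single i j a))
    rw [hvanish hi hj, Matrix.zero_apply] at h
    rcases neg_one_pow_eq_or A (m + 1) with hs | hs <;> simpa [hs] using h.symm
  by_cases hp : p = i
  · by_cases hq : q = j
    · subst hp hq; simp
    · subst hp
      rw [hright (Ne.symm hpq) hq, single_apply_of_ne]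
      exact fun h => hq h.2.symm
  rw [single_apply_of_ne _ _ _ _ _ (fun h => hp h.1.symm)]
  by_cases hp' : p = j
  · by_cases hq : q = i
    · subst hp' hq
      have h := hφ.map_commRight_iterate_of_isCent (hc p) (single q k a) (single k p 1)
      rw [single_mul_single_same, single_mul_single_of_ne _ _ _ _ hpq, sub_zero, mul_one,
        Function.iterate_fixed (commRight_single_single hij a)] at h
      rw [h, Matrix.add_apply, commRight_iterate_apply_left hpq, commRight_iterate_apply_left hpq]
      simp [mul_single_apply, single_mul_apply, hij, hpq, hki, hkj]
    · subst hp'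
      exact hright hq (Ne.symm hpq)
  · exact hleft hp hp'

theorem map_single_mul (hφ : IsLieNDeriv (m + 2) φ) (hc : ∀ i, IsCent (φ (single i i 1)))
    {i j k : ι} (hij : i ≠ j) (hki : k ≠ i) (hkj : k ≠ j) (a b : A) :
    φ (single i j (a * b)) i j =
      φ (single i k a) i k * b + a * φ (single k j b) k j := by
  have h := hφ.map_commRight_iterate_of_isCent (hc j) (single i k a) (single k j b)
  rw [single_mul_single_same, single_mul_single_of_ne _ _ _ _ hij.symm, sub_zero,
    Function.iterate_fixed (commRight_single_single hij _)] at h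
  rw [h, Matrix.add_apply, commRight_iterate_apply_right hij, commRight_iterate_apply_right hij]
  simp [mul_single_apply, single_mul_apply, hki, hkj, add_comm]

theorem exists_isDeriv_map_single_one (hφ : IsLieNDeriv (m + 2) φ)
    (hc : ∀ i, IsCent (φ (single i i 1))) (hι : ∀ i j : ι, ∃ k, k ≠ i ∧ k ≠ j) (o : ι) :
    ∃ d : Matrix ι ι A →ₗ[R] Matrix ι ι A, IsDeriv d ∧ (∀ i, d (single i i 1) = 0) ∧
      ∀ i j, i ≠ j → (φ - d) (single i j 1) = 0 := by
  have htrans {i j k : ι} (hij : i ≠ j) (hki : k ≠ i) (hkj : k ≠ j) :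
      φ (single i j 1) i j = φ (single i k 1) i k + φ (single k j 1) k j := by
    simpa using hφ.map_single_mul hc hij hki hkj 1 1
  have hneg {i j : ι} (hij : i ≠ j) : φ (single i j 1) i j = - φ (single j i 1) j i := by
    obtain ⟨k, hki, hkj⟩ := hι i j
    have h₁ := htrans hki hkj.symm hij.symm
    have h₂ := htrans hkj hki.symm hij
    rw [h₂] at h₁
    have h₃ : φ (single i j 1) i j + φ (single j i 1) j i = 0 := by
      rwa [add_assoc, left_eq_add] at h₁
    exact eq_neg_of_add_eq_zero_left h₃
  let c : ι → A := fun i => if i = o then 0 else φ (single i o 1) i o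
  have hcdiff {i j : ι} (hij : i ≠ j) : φ (single i j 1) i j = c i - c j := by
    by_cases hi : i = o
    · subst hi
      simp [c, hij.symm, hneg hij]
    · by_cases hj : j = o
      · subst hj
        simp [c, hij]
      · rw [htrans hij (Ne.symm hi) (Ne.symm hj), hneg (Ne.symm hj)]
        simp [c, hi, hj, sub_eq_add_neg]
  refine ⟨innerDeriv R (diagonal c), isDeriv_innerDeriv _, fun i => ?_, fun i j hij => ?_⟩
  · rw [innerDeriv_diagonal_single_one, sub_self, single_zero]
  · rw [LinearMap.sub_apply, hφ.map_single_of_ne hc hι hij, hcdiff hij,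
      innerDeriv_diagonal_single_one, sub_self]

theorem exists_isDeriv_map_single (hφ : IsLieNDeriv (m + 2) φ)
    (hc : ∀ i, IsCent (φ (single i i 1))) (hι : ∀ i j : ι, ∃ k, k ≠ i ∧ k ≠ j) (o : ι)
    (hone : ∀ i j, i ≠ j → φ (single i j 1) = 0) :
    ∃ d : Matrix ι ι A →ₗ[R] Matrix ι ι A, IsDeriv d ∧ (∀ i, d (single i i 1) = 0) ∧
      ∀ i j, i ≠ j → ∀ a, (φ - d) (single i j a) = 0 := by
  obtain ⟨o', ho', -⟩ := hι o o
  let f : A →ₗ[R] A := entryLinearMap R A o o' ∘ₗ φ ∘ₗ singleLinearMap R o o'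
  have hf (a : A) : f a = φ (single o o' a) o o' := rfl
  have hrow {i j k : ι} (hij : i ≠ j) (hik : i ≠ k) (a : A) :
      φ (single i j a) i j = φ (single i k a) i k := by
    by_cases hkj : k = j
    · rw [hkj]
    · simpa [hone k j hkj] using hφ.map_single_mul hc hij hik.symm hkj a 1
  have hcol {i j k : ι} (hij : i ≠ j) (hkj : k ≠ j) (a : A) :
      φ (single i j a) i j = φ (single k j a) k j := by
    by_cases hki : k = i
    · rw [hki]
    · simpa [hone i k (Ne.symm hki)] using hφ.map_single_mul hc hij hki hkj 1 a
  have hall {i j : ι} (hij : i ≠ j) (a : A) : φ (single i j a) i j = f a := by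
    obtain ⟨k, hki, hko⟩ := hι i o
    rw [hrow hij hki.symm, hcol hki.symm hko.symm, hrow hko.symm ho'.symm, hf]
  have hfd : IsDeriv f := by
    intro a b
    obtain ⟨k, hko, hko'⟩ := hι o o'
    rw [hf, hφ.map_single_mul hc ho'.symm hko hko', hall hko.symm, hall hko']
  have hf1 : f 1 = 0 := by rw [hf, hone _ _ ho'.symm, Matrix.zero_apply]
  refine ⟨f.mapMatrix, isDeriv_mapMatrix hfd, fun i => ?_, fun i j hij a => ?_⟩
  · rw [LinearMap.mapMatrix_apply, map_single, hf1, single_zero]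
  · rw [LinearMap.sub_apply, LinearMap.mapMatrix_apply, map_single,
      hφ.map_single_of_ne hc hι hij, hall hij, sub_self]

theorem isCent_map (hφ : IsLieNDeriv (m + 2) φ) (hc : ∀ i, IsCent (φ (single i i 1)))
    (hι : ∀ i : ι, ∃ j, j ≠ i) (hoff : ∀ i j, i ≠ j → ∀ a, φ (single i j a) = 0)
    (x : Matrix ι ι A) : IsCent (φ x) := by
  have hsingle (i j : ι) (a : A) : IsCent (φ (single i j a)) := by
    by_cases hij : i = j
    swap
    · intro y
      simp [hoff i j hij]
    subst hij
    obtain ⟨j, hj⟩ := hι i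
    have hz : ∀ p q, p ≠ q → φ (single i i a) p q = 0 := by
      intro p q hpq
      have h := hφ.map_commRight_iterate_succ (hc q) (single i i a)
      have h0 : commRight (single q q 1) (single i i a) = 0 := by
        by_cases hq : q = i
        · subst hq; simp [commRight]
        · exact commRight_single_of_ne hq hq a
      rw [Function.iterate_succ_apply, h0, commRight_iterate_zero, map_zero] at h
      rw [← commRight_iterate_apply_right hpq (m + 1) (φ (single i i a)), ← h, Matrix.zero_apply]
    refine isCent_of_diagonal hz hj fun k hk b => ?_
    have h := hφ.map_commRight_iterate_of_isCent (hc i) (single i i a) (single k i b)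
    have h0 : single i i a * single k i b - single k i b * single i i a =
        single k i (-(b * a)) := by
      simp [hk.symm, ← single_neg]
    rw [h0, Function.iterate_fixed (commRight_single_single hk _), hoff k i hk, hoff k i hk,
      mul_zero, zero_mul, sub_zero, commRight_iterate_zero, zero_add] at h
    have h' := congrFun (congrFun h k) i
    rw [commRight_iterate_apply_right hk, Matrix.sub_apply, mul_single_apply, single_mul_apply] at h'
    simpa [sub_eq_zero] using h'.symm
  intro y
  rw [matrix_eq_sum_single x]
  simp only [map_sum, sum_mul, mul_sum, hsingle _ _ _ y]

theorem isStandard (hφ : IsLieNDeriv (m + 2) φ) (htf : TorsionFreeAt A (m + 1))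
    (hι : ∀ i j : ι, ∃ k, k ≠ i ∧ k ≠ j) (o : ι) : IsStandardLieNDeriv (m + 2) φ := by
  have hι' (i : ι) : ∃ j, j ≠ i := (hι i i).imp fun _ h => h.1
  obtain ⟨d₁, hd₁, hc₁⟩ := hφ.exists_isDeriv_isCent htf hι'
  have hφ₁ := hφ.sub_isDeriv hd₁
  obtain ⟨d₂, hd₂, hz₂, hone⟩ := hφ₁.exists_isDeriv_map_single_one hc₁ hι o
  have hφ₂ := hφ₁.sub_isDeriv hd₂
  have hc₂ (i : ι) : IsCent ((φ - d₁ - d₂) (single i i 1)) := by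
    rw [LinearMap.sub_apply, hz₂, sub_zero]
    exact hc₁ i
  obtain ⟨d₃, hd₃, hz₃, hoff⟩ := hφ₂.exists_isDeriv_map_single hc₂ hι o hone
  have hφ₃ := hφ₂.sub_isDeriv hd₃
  have hc₃ (i : ι) : IsCent ((φ - d₁ - d₂ - d₃) (single i i 1)) := by
    rw [LinearMap.sub_apply, hz₃, sub_zero]
    exact hc₂ i
  have hcent := hφ₃.isCent_map hc₃ hι' hoff
  exact ⟨d₁ + d₂ + d₃, φ - d₁ - d₂ - d₃, (hd₁.add hd₂).add hd₃, hcent,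
    hφ₃.vanishesOnNCommutators hcent, by abel⟩

end IsLieNDeriv

end Matrix

theorem stmt_14 (R : Type*) [CommRing R] (A : Type*) [Ring A] [Algebra R A]
    (n : ℕ) (hn : 2 ≤ n)
    (h2 : TorsionFreeAt A 2) (hn1 : TorsionFreeAt A (n - 1))
    (s : ℕ) (hs : 3 ≤ s)
    (φ : Matrix (Fin s) (Fin s) A →ₗ[R] Matrix (Fin s) (Fin s) A)
    (hφ : IsLieNDeriv n φ) :
    IsStandardLieNDeriv n φ := by
  obtain ⟨m, rfl⟩ := Nat.exists_eq_add_of_le' hn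
  refine hφ.isStandard hn1 (fun i j => ?_) ⟨0, by omega⟩
  have hcard : ({i, j} : Finset (Fin s)).card < (univ : Finset (Fin s)).card := by
    rw [card_univ, Fintype.card_fin]
    exact card_le_two.trans_lt hs
  obtain ⟨k, -, hk⟩ := exists_mem_notMem_of_card_lt_card hcard
  exact ⟨k, by simpa using hk⟩
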